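/- arXiv:0810.1577 — 2 statements merged into one kernel-verified Lean document; each statement's English description precedes it below -/
import Mathlib

section
/- Under Assumption A, if (x₀,ξ₀) ∈ ℝ^{2n} is forward nontrapping with respect to k, then the classical wave operator limit exists: writing (ỹ(t), η̃(t)) = exp(tH_k)(x₀,ξ₀), the limits x₊ = lim_{t→+∞}(ỹ(t) − t η̃(t)) and ξ₊ = lim_{t→+∞} η̃(t) both exist in ℝ^n; that is, S₊(x₀,ξ₀) = lim_{t→+∞} exp(−tH_{k₀}) ∘ exp(tH_k)(x₀,ξ₀) exists. -/
open Real Filter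
open scoped BigOperators Topology

noncomputable section

/-- Euclidean configuration space `ℝⁿ`. -/
abbrev En (n : ℕ) := EuclideanSpace ℝ (Fin n)

/-- Partial derivative `∂f/∂x_j` of a function on `ℝⁿ`. -/
noncomputable def pd {n : ℕ} (f : En n → ℝ) (j : Fin n) (x : En n) : ℝ :=
  fderiv ℝ f x (EuclideanSpace.single j 1)

/-- Japanese bracket `⟨x⟩ = (1+|x|²)^{1/2}` on `ℝⁿ`. -/
noncomputable def jb {n : ℕ} (x : En n) : ℝ := Real.sqrt (1 + ‖x‖ ^ 2)

/-- Japanese bracket `⟨t⟩` on `ℝ`. -/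
noncomputable def jbR (t : ℝ) : ℝ := Real.sqrt (1 + t ^ 2)

/-- Kronecker delta. -/
def kdelta {n : ℕ} (j k : Fin n) : ℝ := if j = k then 1 else 0

/-- Assumption A: smooth symmetric positive-definite coefficients `a_{jk}` which are a
short-range perturbation of `δ_{jk}`, and a potential `V = O(⟨x⟩^{2-μ})`, with symbol-type
bounds on all derivatives. -/
structure AssumptionA (n : ℕ) (a : Fin n → Fin n → En n → ℝ) (V : En n → ℝ) (μ : ℝ) : Prop where
  n_pos : 0 < n
  one_lt_mu : 1 < μ
  smooth_a : ∀ j k, ContDiff ℝ (⊤ : ℕ∞) (a j k)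
  smooth_V : ContDiff ℝ (⊤ : ℕ∞) V
  symm : ∀ j k x, a j k x = a k j x
  posdef : ∀ x (ξ : En n), ξ ≠ 0 → 0 < ∑ j, ∑ k, a j k x * ξ j * ξ k
  decay_a : ∀ (m : ℕ) (j k : Fin n), ∃ C > 0, ∀ x,
      ‖iteratedFDeriv ℝ m (fun y => a j k y - kdelta j k) x‖ ≤ C * jb x ^ (-μ - (m : ℝ))
  decay_V : ∀ (m : ℕ), ∃ C > 0, ∀ x,
      ‖iteratedFDeriv ℝ m V x‖ ≤ C * jb x ^ (2 - μ - (m : ℝ))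

/-- Kinetic energy symbol `k(x,ξ) = ½ Σ a_{jk}(x) ξ_j ξ_k`. -/
noncomputable def ksym {n : ℕ} (a : Fin n → Fin n → En n → ℝ) (x ξ : En n) : ℝ :=
  (1 / 2) * ∑ j, ∑ k, a j k x * ξ j * ξ k

/-- Full symbol `p(x,ξ) = k(x,ξ) + ½|x|² + V(x)`. -/
noncomputable def psym {n : ℕ} (a : Fin n → Fin n → En n → ℝ) (V : En n → ℝ) (x ξ : En n) : ℝ :=
  ksym a x ξ + ‖x‖ ^ 2 / 2 + V x

/-- Scaled symbol `p^λ(x,ξ) = k(x,ξ) + |x|²/(2λ²) + V(x)/λ²`. -/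
noncomputable def plam {n : ℕ} (a : Fin n → Fin n → En n → ℝ) (V : En n → ℝ) (lam : ℝ)
    (x ξ : En n) : ℝ :=
  ksym a x ξ + ‖x‖ ^ 2 / (2 * lam ^ 2) + V x / lam ^ 2

/-- `(y,η)` is a (global) solution of the Hamilton equations of `k(x,ξ)=½Σa_{jk}(x)ξ_jξ_k`. -/
def IsFlowK {n : ℕ} (a : Fin n → Fin n → En n → ℝ) (y η : ℝ → En n) : Prop :=
  (∀ t (j : Fin n), HasDerivAt (fun s => y s j) (∑ i, a j i (y t) * η t i) t) ∧
  (∀ t (j : Fin n), HasDerivAt (fun s => η s j)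
      (-((1 / 2) * ∑ i, ∑ l, pd (a i l) j (y t) * η t i * η t l)) t)

/-- `(y,η)` is a (global) solution of the Hamilton equations of `p(x,ξ)`. -/
def IsFlowP {n : ℕ} (a : Fin n → Fin n → En n → ℝ) (V : En n → ℝ) (y η : ℝ → En n) : Prop :=
  (∀ t (j : Fin n), HasDerivAt (fun s => y s j) (∑ i, a j i (y t) * η t i) t) ∧
  (∀ t (j : Fin n), HasDerivAt (fun s => η s j)
      (-((1 / 2) * ∑ i, ∑ l, pd (a i l) j (y t) * η t i * η t l + y t j + pd V j (y t))) t)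

/-- `(y,η)` is a (global) solution of the Hamilton equations of `p^λ(x,ξ)`. -/
def IsFlowPlam {n : ℕ} (a : Fin n → Fin n → En n → ℝ) (V : En n → ℝ) (lam : ℝ)
    (y η : ℝ → En n) : Prop :=
  (∀ t (j : Fin n), HasDerivAt (fun s => y s j) (∑ i, a j i (y t) * η t i) t) ∧
  (∀ t (j : Fin n), HasDerivAt (fun s => η s j)
      (-((1 / 2) * ∑ i, ∑ l, pd (a i l) j (y t) * η t i * η t l
          + y t j / lam ^ 2 + pd V j (y t) / lam ^ 2)) t)

/-- First (position) component of `exp(-tH_{p₀^λ})` applied to `(y t, η t)`: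
`z^λ(t) = cos(t/λ) y^λ(t) − λ sin(t/λ) η^λ(t)`. -/
noncomputable def zlam {n : ℕ} (lam : ℝ) (y η : ℝ → En n) (t : ℝ) : En n :=
  Real.cos (t / lam) • y t - (lam * Real.sin (t / lam)) • η t

/-- Second (momentum) component: `ζ^λ(t) = λ⁻¹ sin(t/λ) y^λ(t) + cos(t/λ) η^λ(t)`. -/
noncomputable def zetalam {n : ℕ} (lam : ℝ) (y η : ℝ → En n) (t : ℝ) : En n :=
  (lam⁻¹ * Real.sin (t / lam)) • y t + Real.cos (t / lam) • η t

end

/-- The velocity field `∂_ξ k(x,ξ)`. -/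
noncomputable def velocity {n : ℕ} (a : Fin n → Fin n → En n → ℝ) (x ξ : En n) : En n :=
  WithLp.toLp 2 fun j => ∑ i, a j i x * ξ i

/-- The force field `-∂_x k(x,ξ)`. -/
noncomputable def force {n : ℕ} (a : Fin n → Fin n → En n → ℝ) (x ξ : En n) : En n :=
  WithLp.toLp 2 fun j => -((1 / 2) * ∑ i, ∑ l, pd (a i l) j x * ξ i * ξ l)

theorem jb_pos {n : ℕ} (x : En n) : 0 < jb x := by
  unfold jb; positivity

theorem norm_le_jb {n : ℕ} (x : En n) : ‖x‖ ≤ jb x :=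
  Real.le_sqrt_of_sq_le (by linarith)

theorem norm_le_card_mul_of_abs_le {n : ℕ} {x : En n} {B : ℝ} (h : ∀ j, |x j| ≤ B) :
    ‖x‖ ≤ n * B := by
  calc ‖x‖ = ‖∑ j, x j • EuclideanSpace.single j (1 : ℝ)‖ := by
        congr 1
        ext i
        simp [Pi.single_apply]
    _ ≤ ∑ j, ‖x j • EuclideanSpace.single j (1 : ℝ)‖ := norm_sum_le _ _
    _ ≤ ∑ _j : Fin n, B := Finset.sum_le_sum fun j _ => by simpa [norm_smul] using h j
    _ = n * B := by simp

theorem abs_coord_le_norm {n : ℕ} (x : En n) (j : Fin n) : |x j| ≤ ‖x‖ := by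
  simpa using PiLp.norm_apply_le x j

theorem hasDerivAt_iff_coord {n : ℕ} {f : ℝ → En n} {f' : En n} {t : ℝ} :
    HasDerivAt f f' t ↔ ∀ j, HasDerivAt (fun s => f s j) (f' j) t := by
  simp only [hasDerivAt_iff_hasFDerivAt, ← hasFDerivWithinAt_univ, hasFDerivWithinAt_euclidean]
  refine forall_congr' fun j => ?_
  have e : PiLp.proj 2 (fun _ : Fin n => ℝ) j ∘L ContinuousLinearMap.toSpanSingleton ℝ f'
      = ContinuousLinearMap.toSpanSingleton ℝ (f' j) := by
    ext
    simp
  exact e ▸ Iff.rfl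

theorem abs_pd_le {n : ℕ} (f : En n → ℝ) (j : Fin n) (x : En n) :
    |pd f j x| ≤ ‖fderiv ℝ f x‖ := by
  simpa [pd] using (fderiv ℝ f x).le_opNorm (EuclideanSpace.single j 1)

section Bounds

variable {n : ℕ} {a : Fin n → Fin n → En n → ℝ} {V : En n → ℝ} {μ : ℝ}

theorem AssumptionA.exists_coeff_bound (hA : AssumptionA n a V μ) :
    ∃ C > 0, ∀ j k x, |a j k x - kdelta j k| ≤ C * jb x ^ (-μ) := by
  choose C hC h using hA.decay_a 0
  have : Nonempty (Fin n) := ⟨⟨0, hA.n_pos⟩⟩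
  refine ⟨∑ j, ∑ k, C j k, Finset.sum_pos (fun j _ => Finset.sum_pos (fun k _ => hC j k)
    Finset.univ_nonempty) Finset.univ_nonempty, fun j k x => ?_⟩
  have h1 : C j k ≤ ∑ j, ∑ k, C j k :=
    (Finset.single_le_sum (f := fun k => C j k) (fun k _ => (hC j k).le)
      (Finset.mem_univ k)).trans (Finset.single_le_sum (f := fun j => ∑ k, C j k)
        (fun j _ => Finset.sum_nonneg fun k _ => (hC j k).le) (Finset.mem_univ j))
  have h2 := h j k x
  simp only [norm_iteratedFDeriv_zero, Real.norm_eq_abs, Nat.cast_zero, sub_zero] at h2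
  exact h2.trans (mul_le_mul_of_nonneg_right h1 (Real.rpow_nonneg (jb_pos x).le _))

theorem AssumptionA.exists_pd_bound (hA : AssumptionA n a V μ) :
    ∃ C > 0, ∀ j k l x, |pd (a j k) l x| ≤ C * jb x ^ (-μ - 1) := by
  choose C hC h using hA.decay_a 1
  have : Nonempty (Fin n) := ⟨⟨0, hA.n_pos⟩⟩
  refine ⟨∑ j, ∑ k, C j k, Finset.sum_pos (fun j _ => Finset.sum_pos (fun k _ => hC j k)
    Finset.univ_nonempty) Finset.univ_nonempty, fun j k l x => ?_⟩
  have h1 : C j k ≤ ∑ j, ∑ k, C j k :=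
    (Finset.single_le_sum (f := fun k => C j k) (fun k _ => (hC j k).le)
      (Finset.mem_univ k)).trans (Finset.single_le_sum (f := fun j => ∑ k, C j k)
        (fun j _ => Finset.sum_nonneg fun k _ => (hC j k).le) (Finset.mem_univ j))
  have h2 := h j k x
  rw [norm_iteratedFDeriv_one, fderiv_sub_const, Nat.cast_one] at h2
  exact ((abs_pd_le _ _ _).trans h2).trans
    (mul_le_mul_of_nonneg_right h1 (Real.rpow_nonneg (jb_pos x).le _))

theorem AssumptionA.exists_velocity_sub_bound (hA : AssumptionA n a V μ) :
    ∃ C > 0, ∀ x ξ, ‖velocity a x ξ - ξ‖ ≤ C * jb x ^ (-μ) * ‖ξ‖ := by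
  obtain ⟨C, hC, h⟩ := hA.exists_coeff_bound
  have hn : (0 : ℝ) < n := by exact_mod_cast hA.n_pos
  refine ⟨n * (n * C), by positivity, fun x ξ => ?_⟩
  have hJ := Real.rpow_nonneg (jb_pos x).le (-μ)
  have key : ‖velocity a x ξ - ξ‖ ≤ n * (n * (C * jb x ^ (-μ) * ‖ξ‖)) := by
    refine norm_le_card_mul_of_abs_le fun j => ?_
    have e : (velocity a x ξ - ξ) j = ∑ i, (a j i x - kdelta j i) * ξ i := by
      simp [velocity, kdelta, sub_mul, Finset.sum_sub_distrib]
    rw [e]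
    calc |∑ i, (a j i x - kdelta j i) * ξ i|
        ≤ ∑ i, |(a j i x - kdelta j i) * ξ i| := Finset.abs_sum_le_sum_abs _ _
      _ ≤ ∑ _i : Fin n, C * jb x ^ (-μ) * ‖ξ‖ := Finset.sum_le_sum fun i _ => by
          rw [abs_mul]
          exact mul_le_mul (h j i x) (abs_coord_le_norm ξ i) (abs_nonneg _) (by positivity)
      _ = n * (C * jb x ^ (-μ) * ‖ξ‖) := by simp
  calc _ ≤ _ := key
    _ = _ := by ring

theorem AssumptionA.exists_force_bound (hA : AssumptionA n a V μ) :
    ∃ C > 0, ∀ x ξ, ‖force a x ξ‖ ≤ C * jb x ^ (-μ - 1) * ‖ξ‖ ^ 2 := by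
  obtain ⟨C, hC, h⟩ := hA.exists_pd_bound
  have hn : (0 : ℝ) < n := by exact_mod_cast hA.n_pos
  refine ⟨n * ((1 / 2) * (n * (n * C))), by positivity, fun x ξ => ?_⟩
  have hJ := Real.rpow_nonneg (jb_pos x).le (-μ - 1)
  have key : ‖force a x ξ‖ ≤ n * ((1 / 2) * (n * (n * (C * jb x ^ (-μ - 1) * ‖ξ‖ * ‖ξ‖)))) := by
    refine norm_le_card_mul_of_abs_le fun j => ?_
    simp only [force, abs_neg, abs_mul]
    rw [abs_of_pos (by norm_num : (0 : ℝ) < 1 / 2)]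
    refine mul_le_mul_of_nonneg_left ?_ (by norm_num)
    calc |∑ i, ∑ l, pd (a i l) j x * ξ i * ξ l|
        ≤ ∑ i, ∑ l, |pd (a i l) j x * ξ i * ξ l| :=
          (Finset.abs_sum_le_sum_abs _ _).trans
            (Finset.sum_le_sum fun i _ => Finset.abs_sum_le_sum_abs _ _)
      _ ≤ ∑ _i : Fin n, ∑ _l : Fin n, C * jb x ^ (-μ - 1) * ‖ξ‖ * ‖ξ‖ :=
          Finset.sum_le_sum fun i _ => Finset.sum_le_sum fun l _ => by
            rw [abs_mul, abs_mul]
            have := h i l j x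
            have := abs_coord_le_norm ξ i
            have := abs_coord_le_norm ξ l
            gcongr
      _ = n * (n * (C * jb x ^ (-μ - 1) * ‖ξ‖ * ‖ξ‖)) := by simp
  calc _ ≤ _ := key
    _ = _ := by ring

end Bounds

section Flow

variable {n : ℕ} {a : Fin n → Fin n → En n → ℝ} {y η : ℝ → En n}

theorem IsFlowK.hasDerivAt_fst (hk : IsFlowK a y η) (t : ℝ) :
    HasDerivAt y (velocity a (y t) (η t)) t :=
  (hasDerivAt_iff_coord).2 (hk.1 t)

theorem IsFlowK.hasDerivAt_snd (hk : IsFlowK a y η) (t : ℝ) :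
    HasDerivAt η (force a (y t) (η t)) t :=
  (hasDerivAt_iff_coord).2 (hk.2 t)

theorem inner_velocity (a : Fin n → Fin n → En n → ℝ) (x ξ : En n) :
    inner ℝ (velocity a x ξ) ξ = ∑ j, ∑ k, a j k x * ξ j * ξ k := by
  simp only [PiLp.inner_apply, velocity, RCLike.inner_apply, conj_trivial, Finset.mul_sum]
  refine Finset.sum_congr rfl fun j _ => Finset.sum_congr rfl fun k _ => by ring

theorem fderiv_apply_eq_sum_pd (f : En n → ℝ) (x v : En n) :
    fderiv ℝ f x v = ∑ l, pd f l x * v l := by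
  have hv : v = ∑ l, v l • EuclideanSpace.single l (1 : ℝ) := by
    ext i
    simp [Pi.single_apply]
  conv_lhs => rw [hv]
  simp [pd, mul_comm]

/-- Conservation of the kinetic energy along the flow. -/
theorem IsFlowK.energy_eq (hk : IsFlowK a y η) (hd : ∀ j k, Differentiable ℝ (a j k))
    (hs : ∀ j k x, a j k x = a k j x) (t s : ℝ) :
    inner ℝ (velocity a (y t) (η t)) (η t) = inner ℝ (velocity a (y s) (η s)) (η s) := by
  simp only [inner_velocity]
  have key : ∀ t, HasDerivAt (fun t => ∑ j, ∑ k, a j k (y t) * η t j * η t k) 0 t := by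
    intro t
    set v := velocity a (y t) (η t) with hv
    set w := force a (y t) (η t) with hw
    have h1 : HasDerivAt (fun t => ∑ j, ∑ k, a j k (y t) * η t j * η t k)
        (∑ j, ∑ k, (((∑ l, pd (a j k) l (y t) * v l) * η t j + a j k (y t) * w j) * η t k
          + a j k (y t) * η t j * w k)) t := by
      refine HasDerivAt.fun_sum fun j _ => HasDerivAt.fun_sum fun k _ => ?_
      have ha : HasDerivAt (fun t => a j k (y t)) (∑ l, pd (a j k) l (y t) * v l) t := by
        rw [← fderiv_apply_eq_sum_pd]
        exact (hd j k (y t)).hasFDerivAt.comp_hasDerivAt t (hk.hasDerivAt_fst t)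
      have hη := (hasDerivAt_iff_coord).1 (hk.hasDerivAt_snd t)
      exact (ha.mul (hη j)).mul (hη k)
    convert h1 using 1
    simp only [add_mul, Finset.sum_add_distrib]
    have e1 : ∑ j, ∑ k, (∑ l, pd (a j k) l (y t) * v l) * η t j * η t k
        = -2 * ∑ l, w l * v l := by
      have : ∀ l, w l = -((1 / 2) * ∑ i, ∑ m, pd (a i m) l (y t) * η t i * η t m) :=
        fun l => rfl
      simp only [this, Finset.mul_sum, Finset.sum_mul, ← Finset.sum_neg_distrib]
      rw [Finset.sum_comm_cycle]
      refine Finset.sum_congr rfl fun l _ => ?_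
      refine Finset.sum_congr rfl fun j _ => Finset.sum_congr rfl fun k _ => by ring
    have e2 : ∑ j, ∑ k, a j k (y t) * w j * η t k = ∑ l, w l * v l := by
      have : ∀ l, v l = ∑ i, a l i (y t) * η t i := fun l => rfl
      simp only [this, Finset.mul_sum]
      refine Finset.sum_congr rfl fun j _ => Finset.sum_congr rfl fun k _ => by ring
    have e3 : ∑ j, ∑ k, a j k (y t) * η t j * w k = ∑ l, w l * v l := by
      rw [← e2, Finset.sum_comm]
      refine Finset.sum_congr rfl fun j _ => Finset.sum_congr rfl fun k _ => ?_
      rw [hs k j]; ring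
    rw [e1, e2, e3]; ring
  exact is_const_of_deriv_eq_zero (fun t => (key t).differentiableAt) (fun t => (key t).deriv) t s

end Flow

/-- A curve whose derivative is eventually dominated by an integrable power of `t` converges. -/
theorem exists_tendsto_of_deriv_le_rpow {E : Type*} [NormedAddCommGroup E] [NormedSpace ℝ E]
    [CompleteSpace E] {f f' : ℝ → E} {C p : ℝ} (hf : ∀ t, HasDerivAt f (f' t) t) (hp : p < -1)
    (hb : ∀ᶠ t in atTop, ‖f' t‖ ≤ C * t ^ p) : ∃ L, Tendsto f atTop (𝓝 L) := by
  obtain ⟨T, hT⟩ := eventually_atTop.1 hb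
  have hT0 : 0 < max T 1 := by positivity
  have hf' : f' = deriv f := funext fun t => (hf t).deriv.symm
  have hint : MeasureTheory.IntegrableOn f' (Set.Ioi (max T 1)) := by
    refine MeasureTheory.Integrable.mono' ((integrableOn_Ioi_rpow_of_lt hp hT0).const_mul C) ?_ ?_
    · rw [hf']
      exact aestronglyMeasurable_deriv f _
    · refine (MeasureTheory.ae_restrict_mem measurableSet_Ioi).mono fun t ht => ?_
      exact hT t ((le_max_left T 1).trans (le_of_lt ht))
  exact ⟨_, MeasureTheory.tendsto_limUnder_of_hasDerivAt_of_integrableOn_Ioi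
    (fun t _ => hf t) hint⟩

/-- A function whose derivative is eventually at least `c` eventually exceeds `(c / 2) t`. -/
theorem eventually_half_mul_le_of_le_deriv {g g' : ℝ → ℝ} {c : ℝ} (hc : 0 < c)
    (hg : ∀ t, HasDerivAt g (g' t) t) (hb : ∀ᶠ t in atTop, c ≤ g' t) :
    ∀ᶠ t in atTop, c / 2 * t ≤ g t := by
  obtain ⟨T, hT⟩ := eventually_atTop.1 hb
  filter_upwards [eventually_ge_atTop T, eventually_ge_atTop (2 * (T - g T / c))] with t ht ht'
  have h1 : c * (t - T) ≤ g t - g T :=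
    (convex_Ici T).mul_sub_le_image_sub_of_le_deriv
      (fun s _ => (hg s).continuousAt.continuousWithinAt)
      (fun s _ => (hg s).differentiableAt.differentiableWithinAt)
      (fun s hs => by
        rw [(hg s).deriv]
        exact hT s (interior_subset hs)) T Set.self_mem_Ici t ht ht
  have h2 : c * (2 * (T - g T / c)) ≤ c * t := mul_le_mul_of_nonneg_left ht' hc.le
  have h3 : c * (2 * (T - g T / c)) = 2 * (c * T - g T) := by field_simp
  linarith

/-- A nontrapped trajectory has eventually bounded momentum and escapes at least linearly. -/
theorem IsFlowK.eventually_bounds {n : ℕ} {a : Fin n → Fin n → En n → ℝ} {V : En n → ℝ} {μ : ℝ}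
    {y η : ℝ → En n} (hA : AssumptionA n a V μ) (hk : IsFlowK a y η)
    (hnt : Tendsto (fun t => ‖y t‖) atTop atTop) :
    ∃ M > 0, ∃ c > 0, ∀ᶠ t in atTop, ‖η t‖ ≤ M ∧ c * t ≤ jb (y t) := by
  obtain ⟨Cv, hCv, hv⟩ := hA.exists_velocity_sub_bound
  obtain ⟨Cf, hCf, hf⟩ := hA.exists_force_bound
  have hμ := hA.one_lt_mu
  have hcons := hk.energy_eq (fun j k => (hA.smooth_a j k).differentiable (by simp)) hA.symm
  set K := inner ℝ (velocity a (y 0) (η 0)) (η 0) with hK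
  have hKpos : 0 < K := by
    by_contra hneg
    have hη : ∀ t, η t = 0 := by
      intro t
      by_contra h0
      have h1 := hA.posdef (y t) (η t) h0
      rw [← inner_velocity, hcons t 0] at h1
      exact hneg h1
    have hy : ∀ t, HasDerivAt y 0 t := by
      intro t
      have h1 := hk.hasDerivAt_fst t
      have h2 : velocity a (y t) (η t) = 0 := by
        ext j
        simp [velocity, hη t]
      rwa [h2] at h1
    have hconst : ∀ t, y t = y 0 := fun t =>
      is_const_of_deriv_eq_zero (fun t => (hy t).differentiableAt) (fun t => (hy t).deriv) t 0
    simp only [hconst] at hnt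
    exact not_tendsto_const_atTop _ _ hnt
  have hjb : Tendsto (fun t => jb (y t)) atTop atTop :=
    tendsto_atTop_mono (fun t => norm_le_jb (y t)) hnt
  have hdecay : Tendsto (fun t => jb (y t) ^ (-μ)) atTop (𝓝 0) :=
    (tendsto_rpow_neg_atTop (by linarith)).comp hjb
  have hM : ∀ᶠ t in atTop, ‖η t‖ ≤ √(2 * K) := by
    filter_upwards [hdecay.eventually_lt_const (show 0 < 1 / (2 * Cv) by positivity)] with t ht
    refine Real.le_sqrt_of_sq_le ?_
    have h1 : inner ℝ (velocity a (y t) (η t) - η t) (η t) = K - ‖η t‖ ^ 2 := by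
      rw [inner_sub_left, hcons t 0, real_inner_self_eq_norm_sq]
    have h2 := abs_real_inner_le_norm (velocity a (y t) (η t) - η t) (η t)
    rw [h1] at h2
    have h3 : ‖velocity a (y t) (η t) - η t‖ ≤ 1 / 2 * ‖η t‖ := by
      refine (hv _ _).trans (mul_le_mul_of_nonneg_right ?_ (norm_nonneg _))
      calc Cv * jb (y t) ^ (-μ) ≤ Cv * (1 / (2 * Cv)) := by gcongr
        _ = 1 / 2 := by field_simp
    have h4 := mul_le_mul_of_nonneg_right h3 (norm_nonneg (η t))
    have h5 := neg_abs_le (K - ‖η t‖ ^ 2)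
    nlinarith
  set M := √(2 * K) with hMdef
  have hMpos : 0 < M := by positivity
  have hder : ∀ t, HasDerivAt (fun t => inner ℝ (y t) (η t))
      (inner ℝ (y t) (force a (y t) (η t)) + inner ℝ (velocity a (y t) (η t)) (η t)) t :=
    fun t => (hk.hasDerivAt_fst t).inner ℝ (hk.hasDerivAt_snd t)
  have hlow : ∀ᶠ t in atTop, K / 2 ≤
      inner ℝ (y t) (force a (y t) (η t)) + inner ℝ (velocity a (y t) (η t)) (η t) := by
    filter_upwards [hM,
      hdecay.eventually_lt_const (show 0 < K / 2 / (Cf * M ^ 2) by positivity)] with t hMt ht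
    rw [hcons t 0, ← hK]
    have h1 : |inner ℝ (y t) (force a (y t) (η t))| ≤ K / 2 := by
      calc |inner ℝ (y t) (force a (y t) (η t))|
          ≤ ‖y t‖ * ‖force a (y t) (η t)‖ := abs_real_inner_le_norm _ _
        _ ≤ jb (y t) * (Cf * jb (y t) ^ (-μ - 1) * M ^ 2) := by
            refine mul_le_mul (norm_le_jb _) ((hf _ _).trans ?_) (norm_nonneg _) (jb_pos _).le
            have := Real.rpow_nonneg (jb_pos (y t)).le (-μ - 1)
            gcongr
        _ = Cf * M ^ 2 * jb (y t) ^ (-μ) := by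
            rw [Real.rpow_sub_one (jb_pos _).ne']
            have := (jb_pos (y t)).ne'
            field_simp
        _ ≤ Cf * M ^ 2 * (K / 2 / (Cf * M ^ 2)) := by gcongr
        _ = K / 2 := by field_simp
    have h2 := neg_abs_le (inner ℝ (y t) (force a (y t) (η t)))
    linarith
  refine ⟨M, hMpos, K / 2 / 2 / M, by positivity, ?_⟩
  filter_upwards [hM, eventually_half_mul_le_of_le_deriv (by positivity) hder hlow] with t hMt ht
  refine ⟨hMt, ?_⟩
  have h1 : K / 2 / 2 * t ≤ jb (y t) * M :=
    ht.trans ((real_inner_le_norm _ _).trans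
      (mul_le_mul (norm_le_jb _) hMt (norm_nonneg _) (jb_pos _).le))
  calc K / 2 / 2 / M * t = K / 2 / 2 * t / M := by ring
    _ ≤ jb (y t) := (div_le_iff₀ hMpos).2 h1

/-- Under Assumption A, if `(x₀,ξ₀)` is forward nontrapping for `k`, then
the classical wave operator limit exists: with `(ỹ(t), η̃(t)) = exp(tH_k)(x₀,ξ₀)`, both
`x₊ = lim_{t→+∞}(ỹ(t) − t η̃(t))` and `ξ₊ = lim_{t→+∞} η̃(t)` exist; that is,
`S₊(x₀,ξ₀) = lim_{t→+∞} exp(−tH_{k₀}) ∘ exp(tH_k)(x₀,ξ₀)` exists. -/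
theorem stmt_15 {n : ℕ} (a : Fin n → Fin n → En n → ℝ) (V : En n → ℝ) (μ : ℝ)
    (hA : AssumptionA n a V μ) (x₀ ξ₀ : En n)
    (ty tη : ℝ → En n) (hk : IsFlowK a ty tη) (hty0 : ty 0 = x₀) (htη0 : tη 0 = ξ₀)
    (hnt : Filter.Tendsto (fun t => ‖ty t‖) Filter.atTop Filter.atTop) :
    ∃ xp ξp : En n,
      Filter.Tendsto (fun t : ℝ => ty t - t • tη t) Filter.atTop (nhds xp) ∧
      Filter.Tendsto tη Filter.atTop (nhds ξp) := by
  obtain ⟨Cv, hCv, hv⟩ := hA.exists_velocity_sub_bound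
  obtain ⟨Cf, hCf, hf⟩ := hA.exists_force_bound
  obtain ⟨M, hM, c, hc, hb⟩ := hk.eventually_bounds hA hnt
  have hμ := hA.one_lt_mu
  have hpow : ∀ t > 0, ∀ p : ℝ, p ≤ 0 → c * t ≤ jb (ty t) → jb (ty t) ^ p ≤ c ^ p * t ^ p := by
    intro t ht p hp h
    rw [← Real.mul_rpow hc.le ht.le]
    exact Real.rpow_le_rpow_of_nonpos (by positivity) h hp
  have hforce : ∀ᶠ t in atTop,
      ‖force a (ty t) (tη t)‖ ≤ Cf * c ^ (-μ - 1) * M ^ 2 * t ^ (-μ - 1) := by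
    filter_upwards [hb, eventually_gt_atTop 0] with t ⟨h1, h2⟩ ht
    calc ‖force a (ty t) (tη t)‖ ≤ Cf * jb (ty t) ^ (-μ - 1) * ‖tη t‖ ^ 2 := hf _ _
      _ ≤ Cf * (c ^ (-μ - 1) * t ^ (-μ - 1)) * M ^ 2 := by
          have := hpow t ht (-μ - 1) (by linarith) h2
          gcongr
      _ = _ := by ring
  obtain ⟨ξp, hξ⟩ := exists_tendsto_of_deriv_le_rpow hk.hasDerivAt_snd (by linarith) hforce
  have hder : ∀ t, HasDerivAt (fun t : ℝ => ty t - t • tη t)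
      (velocity a (ty t) (tη t) - (t • force a (ty t) (tη t) + (1 : ℝ) • tη t)) t :=
    fun t => (hk.hasDerivAt_fst t).sub ((hasDerivAt_id t).smul (hk.hasDerivAt_snd t))
  have hbound : ∀ᶠ t in atTop,
      ‖velocity a (ty t) (tη t) - (t • force a (ty t) (tη t) + (1 : ℝ) • tη t)‖
        ≤ (Cv * c ^ (-μ) * M + Cf * c ^ (-μ - 1) * M ^ 2) * t ^ (-μ) := by
    filter_upwards [hb, hforce, eventually_gt_atTop 0] with t ⟨h1, h2⟩ h3 ht
    calc ‖velocity a (ty t) (tη t) - (t • force a (ty t) (tη t) + (1 : ℝ) • tη t)‖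
        = ‖(velocity a (ty t) (tη t) - tη t) - t • force a (ty t) (tη t)‖ := by
          congr 1
          module
      _ ≤ ‖velocity a (ty t) (tη t) - tη t‖ + ‖t • force a (ty t) (tη t)‖ := norm_sub_le _ _
      _ = ‖velocity a (ty t) (tη t) - tη t‖ + t * ‖force a (ty t) (tη t)‖ := by
          rw [norm_smul, Real.norm_of_nonneg ht.le]
      _ ≤ Cv * (c ^ (-μ) * t ^ (-μ)) * M + t * (Cf * c ^ (-μ - 1) * M ^ 2 * t ^ (-μ - 1)) := by
          have := hpow t ht (-μ) (by linarith) h2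
          have hv' : ‖velocity a (ty t) (tη t) - tη t‖ ≤ Cv * (c ^ (-μ) * t ^ (-μ)) * M := by
            refine (hv _ _).trans ?_
            gcongr
          gcongr
      _ = _ := by
          rw [Real.rpow_sub_one ht.ne' (-μ)]
          field_simp
  obtain ⟨xp, hx⟩ := exists_tendsto_of_deriv_le_rpow hder (by linarith) hbound
  exact ⟨xp, ξp, hx, hξ⟩
end

section
/- Under Assumption A, fix (x,ξ) ∈ ℝ^{2n} and t ≥ 0, write (ỹ(s), η̃(s)) = exp(sH_k)(x,ξ), and let (z^λ(t), ζ^λ(t)) = exp(−tH_{p₀^λ}) ∘ exp(tH_{p^λ})(x,ξ). Then for each k = 1,…,n, lim_{λ→∞} (d/dt) z^λ_k(t) = Σ_j a_{jk}(ỹ(t)) η̃_j(t) − η̃_k(t) + (t/2) Σ_{i,j} (∂a_{ij}/∂x_k)(ỹ(t)) η̃_i(t) η̃_j(t), which equals the derivative at time t of ỹ_k − t η̃_k, and lim_{λ→∞} (d/dt) ζ^λ_k(t) = −(1/2) Σ_{i,j} (∂a_{ij}/∂x_k)(ỹ(t)) η̃_i(t) η̃_j(t), which equals the derivative at time t of η̃_k.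 -/
open Real Filter
open scoped BigOperators Topology

/-- A perturbed trajectory of a vector field `F` that is Lipschitz on the closed unit neighbourhood
of an exact trajectory stays in that neighbourhood, and the Grönwall estimate holds,
as long as the Grönwall bound is less than one. -/
theorem dist_le_gronwallBound_of_tube {E : Type*} [NormedAddCommGroup E] [NormedSpace ℝ E]
    {F G : E → E} {K : NNReal} {R M c T : ℝ} {u v : ℝ → E}
    (hF : LipschitzOnWith K F (Metric.closedBall 0 R))
    (hG : ∀ p ∈ Metric.closedBall (0 : E) R, ‖G p‖ ≤ M)
    (hM : 0 ≤ M)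
    (hu : ∀ s, HasDerivAt u (F (u s)) s)
    (hv : ∀ s, HasDerivAt v (F (v s) + c • G (v s)) s)
    (huv : v 0 = u 0)
    (huR : ∀ s ∈ Set.Icc 0 T, ‖u s‖ + 1 ≤ R)
    (hc : gronwallBound 0 K (|c| * M) T < 1) :
    ∀ s ∈ Set.Icc 0 T, dist (v s) (u s) ≤ gronwallBound 0 K (|c| * M) T := by
  have cu : Continuous u := continuous_iff_continuousAt.2 fun s => (hu s).continuousAt
  have cv : Continuous v := continuous_iff_continuousAt.2 fun s => (hv s).continuousAt
  have key : ∀ τ ∈ Set.Icc 0 T, (∀ s ∈ Set.Ico 0 τ, dist (v s) (u s) ≤ 1) →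
      dist (v τ) (u τ) ≤ gronwallBound 0 K (|c| * M) T := by
    intro τ hτ hle
    have hvR : ∀ s ∈ Set.Ico 0 τ, v s ∈ Metric.closedBall (0 : E) R := by
      intro s hs
      have h1 := hle s hs
      have h2 := huR s ⟨hs.1, hs.2.le.trans hτ.2⟩
      have h3 := norm_le_norm_add_norm_sub' (v s) (u s)
      rw [dist_eq_norm] at h1
      rw [mem_closedBall_zero_iff]
      linarith
    have h := dist_le_of_approx_trajectories_ODE_of_mem (v := fun _ => F)
      (s := fun _ => Metric.closedBall 0 R) (K := K) (εf := |c| * M) (εg := 0) (δ := 0)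
      (fun _ _ => hF) cv.continuousOn (fun s _ => (hv s).hasDerivWithinAt)
      (fun s hs => by
        rw [dist_eq_norm, add_sub_cancel_left, norm_smul, Real.norm_eq_abs]
        exact mul_le_mul_of_nonneg_left (hG _ (hvR s hs)) (abs_nonneg c)) hvR
      cu.continuousOn (fun s _ => (hu s).hasDerivWithinAt) (fun s _ => by simp)
      (fun s hs => by
        have h2 := huR s ⟨hs.1, hs.2.le.trans hτ.2⟩
        rw [mem_closedBall_zero_iff]
        linarith)
      (by simp [huv]) τ ⟨hτ.1, le_rfl⟩
    rw [add_zero, sub_zero] at h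
    exact h.trans (gronwallBound_mono le_rfl (by positivity) K.2 hτ.2)
  have hlt : ∀ s ∈ Set.Icc 0 T, dist (v s) (u s) < 1 := by
    by_contra! hcon
    obtain ⟨s₀, hs₀, hs₀'⟩ := hcon
    have hB : IsCompact (Set.Icc 0 T ∩ {s | 1 ≤ dist (v s) (u s)}) :=
      isCompact_Icc.inter_right (isClosed_le continuous_const (cv.dist cu))
    obtain ⟨τ, ⟨hτ, hτ'⟩, hmin⟩ := hB.exists_isLeast ⟨s₀, hs₀, hs₀'⟩
    have hb := key τ hτ fun s hs => by
      by_contra! hs'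
      exact absurd (hmin ⟨⟨hs.1, hs.2.le.trans hτ.2⟩, hs'.le⟩) (not_le.2 hs.2)
    exact absurd (hb.trans_lt hc) (not_lt.2 hτ')
  exact fun s hs => key s hs fun r hr => (hlt r ⟨hr.1, hr.2.le.trans hs.2⟩).le

/-- Continuous dependence of trajectories of `F + c • G` on the parameter `c` at `c = 0`. -/
theorem tendsto_perturbed_trajectory {E ι : Type*} [NormedAddCommGroup E] [NormedSpace ℝ E]
    [FiniteDimensional ℝ E] {l : Filter ι} {F G : E → E} (hF : ContDiff ℝ 1 F)
    (hG : Continuous G) {c : ι → ℝ} (hc : Tendsto c l (𝓝 0)) {u : ℝ → E} {v : ι → ℝ → E}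
    (hu : ∀ s, HasDerivAt u (F (u s)) s)
    (hv : ∀ᶠ i in l, (∀ s, HasDerivAt (v i) (F (v i s) + c i • G (v i s)) s) ∧ v i 0 = u 0)
    {T : ℝ} (hT : 0 ≤ T) : Tendsto (fun i => v i T) l (𝓝 (u T)) := by
  have cu : Continuous u := continuous_iff_continuousAt.2 fun s => (hu s).continuousAt
  have : ProperSpace E := FiniteDimensional.proper ℝ E
  obtain ⟨R, hR⟩ := (isCompact_Icc (a := (0 : ℝ)) (b := T)).exists_bound_of_continuousOn
    cu.continuousOn
  have hball : IsCompact (Metric.closedBall (0 : E) (R + 1)) := isCompact_closedBall 0 _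
  obtain ⟨K, hK⟩ := hF.contDiffOn.exists_lipschitzOnWith one_ne_zero
    (convex_closedBall (0 : E) (R + 1)) hball
  obtain ⟨M, hM⟩ := hball.exists_bound_of_continuousOn hG.continuousOn
  have hM0 : 0 ≤ M := (norm_nonneg _).trans (hM (u 0) (by
    rw [mem_closedBall_zero_iff]
    linarith [hR 0 ⟨le_rfl, hT⟩]))
  have hlim : Tendsto (fun i => gronwallBound 0 K (|c i| * M) T) l (𝓝 0) := by
    have h1 : Tendsto (fun i => |c i| * M) l (𝓝 0) := by
      simpa using hc.abs.mul_const M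
    have h2 := ((gronwallBound_continuous_ε 0 K T).tendsto 0).comp h1
    rwa [gronwallBound_ε0_δ0] at h2
  rw [tendsto_iff_dist_tendsto_zero]
  refine squeeze_zero' (Eventually.of_forall fun _ => dist_nonneg) ?_ hlim
  filter_upwards [hv, hlim.eventually_lt_const one_pos] with i hi hlt
  exact dist_le_gronwallBound_of_tube hK hM hM0 hu hi.1 hi.2
    (fun s hs => by linarith [hR s hs]) hlt T ⟨hT, le_rfl⟩

theorem hasDerivAt_euclidean_of_apply {n : ℕ} {f : ℝ → En n} {f' : En n} {t : ℝ}
    (h : ∀ j, HasDerivAt (fun s => f s j) (f' j) t) : HasDerivAt f f' t := by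
  rw [hasDerivAt_iff_hasFDerivAt, ← hasFDerivWithinAt_univ, hasFDerivWithinAt_euclidean]
  intro j
  rw [hasFDerivWithinAt_univ]
  refine (h j).hasFDerivAt.congr_fderiv ?_
  ext
  simp

theorem contDiff_pd {n : ℕ} {f : En n → ℝ} (hf : ContDiff ℝ (⊤ : ℕ∞) f) (j : Fin n) :
    ContDiff ℝ 1 (pd f j) :=
  (hf.fderiv_right (m := 1) (WithTop.coe_le_coe.2 le_top)).clm_apply contDiff_const

/-- The Hamilton vector field of `k(x,ξ)`. -/
noncomputable def kField {n : ℕ} (a : Fin n → Fin n → En n → ℝ) (p : En n × En n) : En n × En n :=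
  (WithLp.toLp 2 fun j => ∑ i, a j i p.1 * p.2 i,
    WithLp.toLp 2 fun j => -((1 / 2) * ∑ i, ∑ l, pd (a i l) j p.1 * p.2 i * p.2 l))

/-- The Hamilton vector field of `|x|²/2 + V(x)`. -/
noncomputable def potentialField {n : ℕ} (V : En n → ℝ) (p : En n × En n) : En n × En n :=
  (0, WithLp.toLp 2 fun j => -(p.1 j + pd V j p.1))

theorem contDiff_kField {n : ℕ} {a : Fin n → Fin n → En n → ℝ}
    (ha : ∀ j k, ContDiff ℝ (⊤ : ℕ∞) (a j k)) : ContDiff ℝ 1 (kField a) := by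
  have hp : ∀ i : Fin n, ContDiff ℝ 1 fun p : En n × En n => p.2 i := fun i =>
    contDiff_euclidean.1 contDiff_snd i
  refine ContDiff.prodMk (contDiff_euclidean.2 fun j => ?_) (contDiff_euclidean.2 fun j => ?_)
  · exact ContDiff.sum (s := Finset.univ) fun i _ =>
      (((ha j i).of_le (by exact_mod_cast le_top)).comp contDiff_fst).mul (hp i)
  · exact (contDiff_const.mul (ContDiff.sum fun i _ => ContDiff.sum fun l _ =>
      (((contDiff_pd (ha i l) j).comp contDiff_fst).mul (hp i)).mul (hp l))).neg

theorem continuous_potentialField {n : ℕ} {V : En n → ℝ} (hV : ContDiff ℝ (⊤ : ℕ∞) V) :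
    Continuous (potentialField V) := by
  have h : ∀ j, Continuous (pd V j) := fun j => (contDiff_pd hV j).continuous
  unfold potentialField
  fun_prop

theorem IsFlowK.hasDerivAt {n : ℕ} {a : Fin n → Fin n → En n → ℝ} {y η : ℝ → En n}
    (h : IsFlowK a y η) (s : ℝ) :
    HasDerivAt (fun s => (y s, η s)) (kField a (y s, η s)) s :=
  (hasDerivAt_euclidean_of_apply (h.1 s)).prodMk (hasDerivAt_euclidean_of_apply (h.2 s))

theorem IsFlowPlam.hasDerivAt {n : ℕ} {a : Fin n → Fin n → En n → ℝ} {V : En n → ℝ} {lam : ℝ}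
    {y η : ℝ → En n} (h : IsFlowPlam a V lam y η) (s : ℝ) :
    HasDerivAt (fun s => (y s, η s))
      (kField a (y s, η s) + (lam ^ 2)⁻¹ • potentialField V (y s, η s)) s := by
  refine HasDerivAt.prodMk (hasDerivAt_euclidean_of_apply fun j => ?_)
    (hasDerivAt_euclidean_of_apply fun j => ?_)
  · simpa [kField, potentialField] using h.1 s j
  · refine (h.2 s j).congr_deriv ?_
    simp only [kField, potentialField, Prod.smul_snd, PiLp.add_apply,
      PiLp.smul_apply, smul_eq_mul]
    ring

theorem hasDerivAt_zlam_apply {n : ℕ} {lam t y' η' : ℝ} {y η : ℝ → En n} {k : Fin n}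
    (hlam : lam ≠ 0) (hy : HasDerivAt (fun s => y s k) y' t)
    (hη : HasDerivAt (fun s => η s k) η' t) :
    HasDerivAt (fun s => zlam lam y η s k)
      (-(lam⁻¹ * Real.sin (t / lam)) * y t k + Real.cos (t / lam) * y'
        - (Real.cos (t / lam) * η t k + lam * Real.sin (t / lam) * η')) t := by
  have hd : HasDerivAt (fun s : ℝ => s / lam) (1 / lam) t := (hasDerivAt_id t).div_const lam
  have h := (hd.cos.mul hy).sub ((hd.sin.const_mul lam).mul hη)
  refine (h.congr_deriv ?_).congr_of_eventuallyEq (Eventually.of_forall fun s => ?_)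
  · field_simp
  · simp [zlam]

theorem hasDerivAt_zetalam_apply {n : ℕ} {lam t y' η' : ℝ} {y η : ℝ → En n} {k : Fin n}
    (hy : HasDerivAt (fun s => y s k) y' t) (hη : HasDerivAt (fun s => η s k) η' t) :
    HasDerivAt (fun s => zetalam lam y η s k)
      ((lam ^ 2)⁻¹ * Real.cos (t / lam) * y t k + lam⁻¹ * Real.sin (t / lam) * y'
        + (-(lam⁻¹ * Real.sin (t / lam)) * η t k + Real.cos (t / lam) * η')) t := by
  have hd : HasDerivAt (fun s : ℝ => s / lam) (1 / lam) t := (hasDerivAt_id t).div_const lam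
  have h := ((hd.sin.const_mul lam⁻¹).mul hy).add (hd.cos.mul hη)
  refine (h.congr_deriv ?_).congr_of_eventuallyEq (Eventually.of_forall fun s => ?_)
  · ring
  · simp [zetalam]

theorem tendsto_mul_sin_div_atTop (t : ℝ) :
    Tendsto (fun lam : ℝ => lam * Real.sin (t / lam)) atTop (𝓝 t) := by
  have h0 : Tendsto (fun lam : ℝ => t / lam) atTop (𝓝 0) := tendsto_id.const_div_atTop t
  have h := ((Real.continuous_sinc.tendsto 0).comp h0).const_mul t
  rw [Real.sinc_zero, mul_one] at h
  refine h.congr' ?_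
  filter_upwards [eventually_gt_atTop 0] with lam hlam
  rcases eq_or_ne t 0 with rfl | ht
  · simp
  · rw [Function.comp_apply, Real.sinc_of_ne_zero (div_ne_zero ht hlam.ne')]
    field_simp

/-- Under Assumption A, for fixed `(x,ξ)` and `t ≥ 0`, with
`(ỹ,η̃) = exp(·H_k)(x,ξ)` and `(z^λ,ζ^λ)` the scattering coordinates of the flow of `p^λ`,
one has, for each `k`:
`lim_{λ→∞} (d/dt)z^λ_k(t) = Σ_j a_{jk}(ỹ)η̃_j − η̃_k + (t/2)Σ_{i,j}(∂a_{ij}/∂x_k)(ỹ)η̃_iη̃_j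
  = (d/dt)(ỹ_k − t η̃_k)` and
`lim_{λ→∞} (d/dt)ζ^λ_k(t) = −½Σ_{i,j}(∂a_{ij}/∂x_k)(ỹ)η̃_iη̃_j = (d/dt)η̃_k`. -/
theorem stmt_18 {n : ℕ} (a : Fin n → Fin n → En n → ℝ) (V : En n → ℝ) (μ : ℝ)
    (hA : AssumptionA n a V μ) (x ξ : En n) (t : ℝ) (ht : 0 ≤ t)
    (ty tη : ℝ → En n) (hk : IsFlowK a ty tη) (hty0 : ty 0 = x) (htη0 : tη 0 = ξ)
    (Y H : ℝ → ℝ → En n)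
    (hYH : ∀ lam : ℝ, 0 < lam →
      IsFlowPlam a V lam (Y lam) (H lam) ∧ Y lam 0 = x ∧ H lam 0 = ξ) :
    ∀ k : Fin n,
      (Filter.Tendsto (fun lam : ℝ => deriv (fun s => zlam lam (Y lam) (H lam) s k) t)
          Filter.atTop
          (nhds (∑ j, a j k (ty t) * tη t j - tη t k
            + t / 2 * ∑ i, ∑ j, pd (a i j) k (ty t) * tη t i * tη t j)) ∧
        (∑ j, a j k (ty t) * tη t j - tη t k
            + t / 2 * ∑ i, ∑ j, pd (a i j) k (ty t) * tη t i * tη t j)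
          = deriv (fun s => ty s k - s * tη s k) t) ∧
      (Filter.Tendsto (fun lam : ℝ => deriv (fun s => zetalam lam (Y lam) (H lam) s k) t)
          Filter.atTop
          (nhds (-((1 / 2) * ∑ i, ∑ j, pd (a i j) k (ty t) * tη t i * tη t j))) ∧
        -((1 / 2) * ∑ i, ∑ j, pd (a i j) k (ty t) * tη t i * tη t j)
          = deriv (fun s => tη s k) t) := by
  have hc : Tendsto (fun lam : ℝ => (lam ^ 2)⁻¹) atTop (𝓝 0) :=
    tendsto_inv_atTop_zero.comp (tendsto_pow_atTop two_ne_zero)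
  have hF := contDiff_kField hA.smooth_a
  have hG := continuous_potentialField hA.smooth_V
  have hflow : Tendsto (fun lam => (Y lam t, H lam t)) atTop (𝓝 (ty t, tη t)) :=
    tendsto_perturbed_trajectory (u := fun s => (ty s, tη s)) (v := fun lam s => (Y lam s, H lam s))
      hF hG hc hk.hasDerivAt
      (by
        filter_upwards [eventually_gt_atTop 0] with lam hlam
        obtain ⟨h, hY, hH⟩ := hYH lam hlam
        exact ⟨h.hasDerivAt, by simp only [hY, hH, hty0, htη0]⟩) ht
  have hfield := (((hF.continuous.tendsto _).comp hflow).add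
    (hc.smul ((hG.tendsto _).comp hflow)))
  rw [zero_smul, add_zero] at hfield
  intro k
  have happly : ∀ p : En n, Tendsto (fun q : En n => q k) (𝓝 p) (𝓝 (p k)) := fun p =>
    (by fun_prop : Continuous fun q : En n => q k).tendsto p
  have hY := (happly _).comp hflow.fst_nhds
  have hH := (happly _).comp hflow.snd_nhds
  have hY' := (happly _).comp hfield.fst_nhds
  have hH' := (happly _).comp hfield.snd_nhds
  have hd (lam : ℝ) (hlam : 0 < lam) :=
    (hYH lam hlam).1.hasDerivAt t
  have hdiv : Tendsto (fun lam : ℝ => t / lam) atTop (𝓝 0) := tendsto_id.const_div_atTop t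
  have hcos : Tendsto (fun lam : ℝ => Real.cos (t / lam)) atTop (𝓝 1) := by
    simpa [Function.comp_def] using (Real.continuous_cos.tendsto 0).comp hdiv
  have hsin : Tendsto (fun lam : ℝ => lam⁻¹ * Real.sin (t / lam)) atTop (𝓝 0) := by
    simpa using tendsto_inv_atTop_zero.mul ((Real.continuous_sin.tendsto 0).comp hdiv)
  have hcoord {f : ℝ → En n} {f' : En n} (h : HasDerivAt f f' t) :
      HasDerivAt (fun s => f s k) (f' k) t :=
    (EuclideanSpace.proj (𝕜 := ℝ) k).hasFDerivAt.comp_hasDerivAt t h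
  have hYd (lam : ℝ) (hlam : 0 < lam) := hcoord (hd lam hlam).fst
  have hHd (lam : ℝ) (hlam : 0 < lam) := hcoord (hd lam hlam).snd
  rw [Finset.sum_congr rfl fun j _ => by rw [hA.symm j k]]
  refine ⟨⟨?_, ?_⟩, ?_, (hk.2 t k).deriv.symm⟩
  · have hlim := ((hsin.neg.mul hY).add (hcos.mul hY')).sub
      ((hcos.mul hH).add ((tendsto_mul_sin_div_atTop t).mul hH'))
    refine Tendsto.congr' ?_ (hlim.trans_eq (congrArg _ ?_))
    · filter_upwards [eventually_gt_atTop 0] with lam hlam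
      exact (hasDerivAt_zlam_apply hlam.ne' (hYd lam hlam) (hHd lam hlam)).deriv.symm
    · simp only [kField]
      ring
  · have h : HasDerivAt (fun s => ty s k - s * tη s k) _ t :=
      (hk.1 t k).sub ((hasDerivAt_id t).mul (hk.2 t k))
    rw [h.deriv, id]
    ring
  · have hlim := ((hc.mul hcos).mul hY).add (hsin.mul hY') |>.add
      ((hsin.neg.mul hH).add (hcos.mul hH'))
    refine Tendsto.congr' ?_ (hlim.trans_eq (congrArg _ ?_))
    · filter_upwards [eventually_gt_atTop 0] with lam hlam
      exact (hasDerivAt_zetalam_apply (hYd lam hlam) (hHd lam hlam)).deriv.symm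
    · simp only [kField]
      ring
end
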